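/- For all τ in the complex upper half-plane and all z ∈ ℂ: ch[1,1](τ,z)² = (1/2)·[η(τ)³/(η(τ/2)η(2τ)) − η(τ/2)η(2τ)/η(τ)²]·ch[2,0](τ,z) − (1/2)·[η(τ)³/(η(τ/2)η(2τ)) + η(τ/2)η(2τ)/η(τ)²]·ch[2,2](τ,z). -/

import Mathlib

open Complex

/-- Jacobi theta function `θ_{j,m}(τ,z) = Σ_{n ∈ j/(2m)+ℤ} q^{m n²} e^{2πi m n z}`. -/
noncomputable def jTheta (j m : ℝ) (τ z : ℂ) : ℂ :=
  ∑' n : ℤ, Complex.exp (2 * (Real.pi : ℂ) * Complex.I * (m : ℂ) *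
    (((j / (2 * m) + (n : ℝ) : ℝ) : ℂ) ^ 2 * τ + ((j / (2 * m) + (n : ℝ) : ℝ) : ℂ) * z))

/-- `q^a := e^{2πiaτ}`. -/
noncomputable def qpow (τ : ℂ) (a : ℝ) : ℂ :=
  Complex.exp (2 * (Real.pi : ℂ) * Complex.I * (a : ℂ) * τ)

/-- Dedekind eta function. -/
noncomputable def dedekindEta (τ : ℂ) : ℂ :=
  Complex.exp ((Real.pi : ℂ) * Complex.I * τ / 12) *
    ∏' n : ℕ, (1 - Complex.exp (2 * (Real.pi : ℂ) * Complex.I * ((n : ℂ) + 1) * τ))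

/-- Mumford theta `ϑ00`. -/
noncomputable def v00 (τ z : ℂ) : ℂ := jTheta 0 2 τ z + jTheta 2 2 τ z
/-- Mumford theta `ϑ01`. -/
noncomputable def v01 (τ z : ℂ) : ℂ := jTheta 0 2 τ z - jTheta 2 2 τ z
/-- Mumford theta `ϑ10`. -/
noncomputable def v10 (τ z : ℂ) : ℂ := jTheta 1 2 τ z + jTheta (-1) 2 τ z
/-- N=3 character `ch^{(+)}_{H(Λ^{[K(1),0]})}`. -/
noncomputable def ch10 (τ z : ℂ) : ℂ := -(jTheta 0 1 τ z) / dedekindEta τ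
/-- N=3 character `ch^{(+)}_{H(Λ^{[K(1),1]})}`. -/
noncomputable def ch11 (τ z : ℂ) : ℂ := -Complex.I * (jTheta 1 1 τ z / dedekindEta τ)
/-- N=3 character `ch^{(+)}_{H(Λ^{[K(2),0]})}`. -/
noncomputable def ch20 (τ z : ℂ) : ℂ :=
  -(1 / 2) * ((dedekindEta (τ / 2) / (dedekindEta τ * dedekindEta (2 * τ))) * v01 τ z
    + (1 / (dedekindEta (τ / 2) * dedekindEta (2 * τ))) * v00 τ z)
/-- N=3 character `ch^{(+)}_{H(Λ^{[K(2),2]})}`. -/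
noncomputable def ch22 (τ z : ℂ) : ℂ :=
  -(1 / 2) * ((dedekindEta (τ / 2) / (dedekindEta τ * dedekindEta (2 * τ))) * v01 τ z
    - (1 / (dedekindEta (τ / 2) * dedekindEta (2 * τ))) * v00 τ z)
/-- N=3 character `ch^{(+)}_{H(Λ^{[K(2),1]})}`. -/
noncomputable def ch21 (τ z : ℂ) : ℂ :=
  Complex.I * (dedekindEta (2 * τ) / (dedekindEta (τ / 2) * dedekindEta τ)) * v10 τ z
/-- N=3 character `ch^{(+)}_{H(Λ^{[K(4),1]})}`. -/
noncomputable def ch41 (τ z : ℂ) : ℂ :=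
  (Complex.I / 2) * (1 / (dedekindEta (τ / 2) * dedekindEta (2 * τ))) *
    (v01 τ z * v10 τ z + (dedekindEta (2 * τ) / (dedekindEta τ) ^ 2) * v00 τ z * v10 τ z)
/-- N=3 character `ch^{(+)}_{H(Λ^{[K(4),3]})}`. -/
noncomputable def ch43 (τ z : ℂ) : ℂ :=
  (Complex.I / 2) * (1 / (dedekindEta (τ / 2) * dedekindEta (2 * τ))) *
    (v01 τ z * v10 τ z - (dedekindEta (2 * τ) / (dedekindEta τ) ^ 2) * v00 τ z * v10 τ z)

/-- The finite `q`-Pochhammer symbol `(q; q)_n`. -/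
noncomputable def qFact (q : ℂ) (n : ℕ) : ℂ := ∏ j ∈ Finset.range n, (1 - q ^ (j + 1))

/-- The Gaussian binomial coefficient. -/
noncomputable def gaussBinom (q : ℂ) : ℕ → ℕ → ℂ
  | _, 0 => 1
  | 0, _ + 1 => 0
  | n + 1, k + 1 => gaussBinom q n k + q ^ (k + 1) * gaussBinom q n (k + 1)

lemma gaussBinom_zero_right (q : ℂ) (n : ℕ) : gaussBinom q n 0 = 1 := by
  cases n <;> simp [gaussBinom]

lemma gaussBinom_of_lt (q : ℂ) {n k : ℕ} (h : n < k) : gaussBinom q n k = 0 := by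
  induction n generalizing k with
  | zero => obtain ⟨k, rfl⟩ := Nat.exists_eq_succ_of_ne_zero h.ne'; simp [gaussBinom]
  | succ n ih =>
    obtain ⟨k, rfl⟩ := Nat.exists_eq_succ_of_ne_zero (by omega : k ≠ 0)
    simp [gaussBinom, ih (by omega : n < k), ih (by omega : n < k + 1)]

lemma gaussBinom_self (q : ℂ) (n : ℕ) : gaussBinom q n n = 1 := by
  induction n with
  | zero => simp [gaussBinom]
  | succ n ih => simp [gaussBinom, ih, gaussBinom_of_lt]

lemma gaussBinom_add_mul (q : ℂ) (a b : ℕ) :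
    gaussBinom q (a + b) a * (qFact q a * qFact q b) = qFact q (a + b) := by
  induction h : a + b generalizing a b with
  | zero =>
    obtain ⟨rfl, rfl⟩ : a = 0 ∧ b = 0 := by omega
    simp [gaussBinom, qFact]
  | succ n ih =>
    rcases a with _ | a
    · obtain rfl : b = n + 1 := by omega
      simp [gaussBinom, qFact]
    rcases b with _ | b
    · obtain rfl : a = n := by omega
      rw [gaussBinom_self]
      simp [qFact]
    have h1 := ih a (b + 1) (by omega)
    have h2 := ih (a + 1) b (by omega)
    have hs : ∀ m, qFact q (m + 1) = qFact q m * (1 - q ^ (m + 1)) := fun m => by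
      simp [qFact, Finset.prod_range_succ]
    rw [hs] at h1 h2
    rw [hs, hs, hs, gaussBinom]
    obtain rfl : n = a + b + 1 := by omega
    have h3 : q ^ (a + b + 1 + 1) = q ^ (a + 1) * q ^ (b + 1) := by ring
    rw [h3]
    linear_combination (1 - q ^ (a + 1)) * h1 + q ^ (a + 1) * (1 - q ^ (b + 1)) * h2

/-- The `q`-binomial theorem. -/
lemma prod_one_add_pow_mul (q t : ℂ) (n : ℕ) :
    ∏ j ∈ Finset.range n, (1 + q ^ j * t) =
      ∑ k ∈ Finset.range (n + 1), gaussBinom q n k * (q ^ k.choose 2 * t ^ k) := by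
  induction n generalizing t with
  | zero => simp [gaussBinom]
  | succ n ih =>
    have h : ∀ j, 1 + q ^ (j + 1) * t = 1 + q ^ j * (q * t) := fun j => by ring
    rw [Finset.prod_range_succ']
    simp_rw [h]
    rw [ih, Finset.sum_range_succ' _ (n + 1)]
    have h1 : ∑ k ∈ Finset.range (n + 1), gaussBinom q n k * (q ^ k.choose 2 * (q * t) ^ k) =
        ∑ k ∈ Finset.range (n + 1),
          gaussBinom q n (k + 1) * (q ^ (k + 1).choose 2 * (q * t) ^ (k + 1)) + 1 := by
      have := Finset.sum_range_succ' (fun k =>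
        gaussBinom q n k * (q ^ k.choose 2 * (q * t) ^ k)) (n + 1)
      rw [Finset.sum_range_succ, gaussBinom_of_lt q (Nat.lt_succ_self n)] at this
      simpa [gaussBinom_zero_right] using this
    have h2 : ∀ k, gaussBinom q (n + 1) (k + 1) * (q ^ (k + 1).choose 2 * t ^ (k + 1)) =
        gaussBinom q n (k + 1) * (q ^ (k + 1).choose 2 * (q * t) ^ (k + 1)) +
          t * (gaussBinom q n k * (q ^ k.choose 2 * (q * t) ^ k)) := fun k => by
      rw [gaussBinom, Nat.choose_succ_succ' k 1, Nat.choose_one_right]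
      ring
    simp_rw [h2, Finset.sum_add_distrib, ← Finset.mul_sum]
    simp only [gaussBinom_zero_right, Nat.choose_zero_succ, pow_zero, mul_one, one_mul]
    linear_combination h1

/-- A finite form of the Jacobi triple product at `z = 0`. -/
lemma prod_one_add_pow_odd_sq {x : ℂ} (hx : x ≠ 0) (N : ℕ) :
    ∏ j ∈ Finset.range N, (1 + x ^ (2 * j + 1)) ^ 2 =
      ∑ k ∈ Finset.range (2 * N + 1),
        gaussBinom (x ^ 2) (2 * N) k * x ^ ((k : ℤ) - N).natAbs ^ 2 := by
  have h1 : ∀ M : ℕ, x ^ M ^ 2 * ∏ j ∈ Finset.range M, (1 + (x ^ (2 * j + 1))⁻¹) =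
      ∏ j ∈ Finset.range M, (1 + x ^ (2 * j + 1)) := fun M => by
    induction M with
    | zero => simp
    | succ M ih =>
      rw [Finset.prod_range_succ, Finset.prod_range_succ, ← ih]
      field_simp
      ring
  have h2 : x ^ N ^ 2 * ∏ j ∈ Finset.range (2 * N), (1 + (x ^ 2) ^ j * (x * (x ^ (2 * N))⁻¹)) =
      ∏ j ∈ Finset.range N, (1 + x ^ (2 * j + 1)) ^ 2 := by
    rw [two_mul N, Finset.prod_range_add, ← Finset.prod_range_reflect, Finset.prod_pow,
      sq (∏ j ∈ _, _)]
    nth_rewrite 2 [← h1]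
    rw [mul_left_comm (∏ j ∈ Finset.range N, (1 + x ^ (2 * j + 1))),
      mul_comm (∏ j ∈ Finset.range N, (1 + x ^ (2 * j + 1)))]
    congr 2
    · refine Finset.prod_congr rfl fun j hj => ?_
      have hj := Finset.mem_range.mp hj
      obtain ⟨i, rfl⟩ : ∃ i, N = j + 1 + i := ⟨N - (j + 1), by omega⟩
      rw [show j + 1 + i - 1 - j = i by omega]
      field_simp
      ring
    · refine Finset.prod_congr rfl fun j hj => ?_
      field_simp
      ring
  rw [← h2, prod_one_add_pow_mul, Finset.mul_sum]
  refine Finset.sum_congr rfl fun k _ => ?_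
  have h3 : x ^ ((k : ℤ) - N).natAbs ^ 2 * x ^ (2 * N * k) = x ^ (N ^ 2 + k ^ 2) := by
    rw [← pow_add]
    congr 1
    zify
    rw [sq_abs]
    ring
  have h4 : 2 * k.choose 2 + k = k ^ 2 := by
    rw [Nat.choose_two_right, Nat.mul_div_cancel' (Nat.even_mul_pred_self k).two_dvd]
    cases k <;> simp; ring
  rw [eq_comm, mul_left_comm]
  congr 1
  rw [mul_pow, inv_pow, ← pow_mul, ← pow_mul, eq_comm, ← mul_assoc, ← mul_assoc,
    mul_inv_eq_iff_eq_mul₀ (pow_ne_zero _ hx), h3, ← h4]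
  ring

/-- Euler's function `∏ (1 - q ^ n)`. -/
noncomputable def eulerPhi (q : ℂ) : ℂ := ∏' n : ℕ, (1 - q ^ (n + 1))

lemma summable_norm_pow_of_le {x : ℂ} (hx : ‖x‖ < 1) {f : ℕ → ℕ} (hf : ∀ n, n ≤ f n) :
    Summable fun n => ‖x ^ f n‖ :=
  (summable_geometric_of_lt_one (norm_nonneg x) hx).of_nonneg_of_le (fun _ => norm_nonneg _)
    fun n => by
      rw [norm_pow]
      exact pow_le_pow_of_le_one (norm_nonneg _) hx.le (hf n)

lemma one_sub_pow_succ_ne_zero {q : ℂ} (hq : ‖q‖ < 1) (n : ℕ) : 1 - q ^ (n + 1) ≠ 0 := by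
  intro h
  have h1 : ‖q‖ ^ (n + 1) < 1 := pow_lt_one₀ (norm_nonneg _) hq n.succ_ne_zero
  rw [← norm_pow, ← sub_eq_zero.mp h, norm_one] at h1
  exact lt_irrefl _ h1

lemma eulerPhi_ne_zero {q : ℂ} (hq : ‖q‖ < 1) : eulerPhi q ≠ 0 := by
  unfold eulerPhi
  simp_rw [sub_eq_add_neg]
  refine tprod_one_add_ne_zero_of_summable (fun n => ?_) ?_
  · rw [← sub_eq_add_neg]
    exact one_sub_pow_succ_ne_zero hq n
  · simpa only [norm_neg] using summable_norm_pow_of_le hq fun n => n.le_succ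

lemma qFact_ne_zero {q : ℂ} (hq : ‖q‖ < 1) (n : ℕ) : qFact q n ≠ 0 :=
  Finset.prod_ne_zero_iff.mpr fun j _ => one_sub_pow_succ_ne_zero hq j

lemma tendsto_qFact {q : ℂ} (hq : ‖q‖ < 1) :
    Filter.Tendsto (qFact q) Filter.atTop (nhds (eulerPhi q)) :=
  (ModularForm.multipliable_one_sub_pow hq).hasProd.tendsto_prod_nat

lemma gaussBinom_add {q : ℂ} (hq : ‖q‖ < 1) (a b : ℕ) :
    gaussBinom q (a + b) a = qFact q (a + b) * ((qFact q a)⁻¹ * (qFact q b)⁻¹) := by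
  rw [← gaussBinom_add_mul q a b]
  field_simp [qFact_ne_zero hq a, qFact_ne_zero hq b]

lemma exists_norm_gaussBinom_le {q : ℂ} (hq : ‖q‖ < 1) :
    ∃ C, ∀ n k, ‖gaussBinom q n k‖ ≤ C := by
  obtain ⟨C, hC⟩ := (Metric.isBounded_range_of_tendsto _ (tendsto_qFact hq)).exists_norm_le
  obtain ⟨D, hD⟩ := (Metric.isBounded_range_of_tendsto _
    ((tendsto_qFact hq).inv₀ (eulerPhi_ne_zero hq))).exists_norm_le
  simp only [Set.forall_mem_range] at hC hD
  have hC0 : 0 ≤ C := (norm_nonneg _).trans (hC 0)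
  have hD0 : 0 ≤ D := (norm_nonneg _).trans (hD 0)
  refine ⟨C * (D * D), fun n k => ?_⟩
  rcases lt_or_ge n k with h | h
  · rw [gaussBinom_of_lt q h, norm_zero]
    positivity
  · obtain ⟨b, rfl⟩ := Nat.exists_eq_add_of_le h
    rw [gaussBinom_add hq, norm_mul, norm_mul]
    exact mul_le_mul (hC _) (mul_le_mul (hD k) (hD b) (norm_nonneg _) hD0) (by positivity) hC0

lemma summable_norm_pow_natAbs_sq {x : ℂ} (hx : ‖x‖ < 1) :
    Summable fun k : ℤ => ‖x ^ k.natAbs ^ 2‖ := by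
  have h := summable_norm_pow_of_le hx (f := fun n => n ^ 2) fun n => Nat.le_self_pow two_ne_zero n
  exact Summable.of_nat_of_neg (by simpa using h) (by simpa using h)

lemma multipliable_one_add_pow_odd {x : ℂ} (hx : ‖x‖ < 1) :
    Multipliable fun n : ℕ => 1 + x ^ (2 * n + 1) :=
  multipliable_one_add_of_summable (summable_norm_pow_of_le hx fun n => by omega)

/-- The Jacobi triple product at `z = 0`. -/
lemma tsum_pow_natAbs_sq {x : ℂ} (hx0 : x ≠ 0) (hx : ‖x‖ < 1) :
    ∑' k : ℤ, x ^ k.natAbs ^ 2 = eulerPhi (x ^ 2) * (∏' n : ℕ, (1 + x ^ (2 * n + 1))) ^ 2 := by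
  have hq : ‖x ^ 2‖ < 1 := by
    rw [norm_pow]
    exact pow_lt_one₀ (norm_nonneg _) hx two_ne_zero
  obtain ⟨C, hC⟩ := exists_norm_gaussBinom_le hq
  have hC0 : 0 ≤ C := (norm_nonneg _).trans (hC 0 0)
  set f : ℕ → ℤ → ℂ := fun N k =>
    if k.natAbs ≤ N then gaussBinom (x ^ 2) (2 * N) (k + N).toNat * x ^ k.natAbs ^ 2 else 0 with hf
  have h1 : ∀ N, ∑' k, f N k = ∏ j ∈ Finset.range N, (1 + x ^ (2 * j + 1)) ^ 2 := fun N => by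
    rw [prod_one_add_pow_odd_sq hx0, tsum_eq_sum (s := Finset.Icc (-(N : ℤ)) N)]
    · refine Finset.sum_nbij' (fun k => (k + N).toNat) (fun k => (k : ℤ) - N) ?_ ?_ ?_ ?_ ?_
      · intro k hk; simp only [Finset.mem_Icc, Finset.mem_range] at *; omega
      · intro k hk; simp only [Finset.mem_Icc, Finset.mem_range] at *; omega
      · intro k hk; simp only [Finset.mem_Icc] at *; omega
      · intro k hk; simp only [Finset.mem_range] at *; omega
      · intro k hk
        simp only [Finset.mem_Icc] at hk
        rw [hf]
        simp only
        rw [if_pos (by omega), show (((k + N).toNat : ℕ) : ℤ) - N = k by omega]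
    · intro k hk
      rw [Finset.mem_Icc] at hk
      exact if_neg (by omega)
  have h2 : Filter.Tendsto (fun N => ∑' k, f N k) Filter.atTop
      (nhds (∑' k : ℤ, (eulerPhi (x ^ 2))⁻¹ * x ^ k.natAbs ^ 2)) := by
    refine tendsto_tsum_of_dominated_convergence (bound := fun k : ℤ => C * ‖x ^ k.natAbs ^ 2‖)
      ((summable_norm_pow_natAbs_sq hx).mul_left C) (fun k => ?_) (.of_forall fun N k => ?_)
    · have e : ∀ᶠ N : ℕ in Filter.atTop, qFact (x ^ 2) (2 * N) *
          ((qFact (x ^ 2) (k + N).toNat)⁻¹ * (qFact (x ^ 2) (N - k).toNat)⁻¹) *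
            x ^ k.natAbs ^ 2 = f N k := by
        filter_upwards [Filter.eventually_ge_atTop k.natAbs] with N hN
        rw [hf]
        simp only
        rw [if_pos hN, show 2 * N = (k + N).toNat + (N - k).toNat by omega, gaussBinom_add hq]
      refine Filter.Tendsto.congr' e (Filter.Tendsto.mul_const _ ?_)
      have hP := tendsto_qFact hq
      have hPi := hP.inv₀ (eulerPhi_ne_zero hq)
      have t1 : Filter.Tendsto (fun N : ℕ => 2 * N) Filter.atTop Filter.atTop :=
        Filter.tendsto_atTop_atTop.2 fun b => ⟨b, fun a h => by omega⟩
      have t2 : Filter.Tendsto (fun N : ℕ => (k + N).toNat) Filter.atTop Filter.atTop :=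
        Filter.tendsto_atTop_atTop.2 fun b => ⟨b + k.natAbs, fun a h => by omega⟩
      have t3 : Filter.Tendsto (fun N : ℕ => ((N : ℤ) - k).toNat) Filter.atTop Filter.atTop :=
        Filter.tendsto_atTop_atTop.2 fun b => ⟨b + k.natAbs, fun a h => by omega⟩
      have := (hP.comp t1).mul ((hPi.comp t2).mul (hPi.comp t3))
      rwa [mul_inv_cancel_left₀ (eulerPhi_ne_zero hq)] at this
    · rw [hf]
      simp only
      split_ifs
      · rw [norm_mul]
        exact mul_le_mul_of_nonneg_right (hC _ _) (norm_nonneg _)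
      · rw [norm_zero]
        positivity
  have h3 := (multipliable_one_add_pow_odd hx).hasProd.tendsto_prod_nat.pow 2
  simp_rw [h1, Finset.prod_pow] at h2
  have h4 := tendsto_nhds_unique h2 h3
  rw [tsum_mul_left] at h4
  rw [← h4, mul_inv_cancel_left₀ (eulerPhi_ne_zero hq)]

lemma eulerPhi_eq_mul {x : ℂ} (hx : ‖x‖ < 1) :
    eulerPhi x = (∏' n : ℕ, (1 - x ^ (2 * n + 1))) * eulerPhi (x ^ 2) := by
  have hq : ‖x ^ 2‖ < 1 := by
    rw [norm_pow]
    exact pow_lt_one₀ (norm_nonneg _) hx two_ne_zero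
  have h : ∀ n, (x ^ 2) ^ (n + 1) = x ^ (2 * n + 1 + 1) := fun n => by ring
  have h1 := ModularForm.multipliable_one_sub_pow hq
  have h2 := multipliable_one_add_pow_odd (x := -x) (by rwa [norm_neg])
  simp_rw [Odd.neg_pow (odd_two_mul_add_one _), ← sub_eq_add_neg] at h2
  simp_rw [h] at h1
  have h3 := tprod_even_mul_odd (f := fun n => 1 - x ^ (n + 1)) h2 h1
  simp_rw [← h] at h3
  exact h3.symm

lemma tprod_one_add_mul_tprod_one_sub {x : ℂ} (hx : ‖x‖ < 1) :
    (∏' n : ℕ, (1 + x ^ (2 * n + 1))) * ∏' n : ℕ, (1 - x ^ (2 * n + 1)) =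
      ∏' n : ℕ, (1 - (x ^ 2) ^ (2 * n + 1)) := by
  have h2 := multipliable_one_add_pow_odd (x := -x) (by rwa [norm_neg])
  simp_rw [Odd.neg_pow (odd_two_mul_add_one _), ← sub_eq_add_neg] at h2
  rw [← (multipliable_one_add_pow_odd hx).tprod_mul h2]
  exact tprod_congr fun n => by ring

lemma tsum_pow_natAbs_sq_mul {x : ℂ} (hx0 : x ≠ 0) (hx : ‖x‖ < 1) :
    (∑' k : ℤ, x ^ k.natAbs ^ 2) * (eulerPhi x * eulerPhi (x ^ 4)) ^ 2 = eulerPhi (x ^ 2) ^ 5 := by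
  have hq : ‖x ^ 2‖ < 1 := by
    rw [norm_pow]
    exact pow_lt_one₀ (norm_nonneg _) hx two_ne_zero
  have h := eulerPhi_eq_mul hq
  rw [← tprod_one_add_mul_tprod_one_sub hx, ← pow_mul] at h
  rw [tsum_pow_natAbs_sq hx0 hx, eulerPhi_eq_mul hx]
  set p := eulerPhi (x ^ 2)
  set A := ∏' n : ℕ, (1 + x ^ (2 * n + 1))
  set B := ∏' n : ℕ, (1 - x ^ (2 * n + 1))
  calc p * A ^ 2 * (B * p * eulerPhi (x ^ 4)) ^ 2 = p ^ 3 * (A * B * eulerPhi (x ^ (2 * 2))) ^ 2 := by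
        ring
    _ = p ^ 5 := by rw [← h]; ring

lemma tsum_neg_pow_natAbs_sq_mul {x : ℂ} (hx0 : x ≠ 0) (hx : ‖x‖ < 1) :
    (∑' k : ℤ, (-x) ^ k.natAbs ^ 2) * eulerPhi (x ^ 2) = eulerPhi x ^ 2 := by
  rw [tsum_pow_natAbs_sq (neg_ne_zero.mpr hx0) (by rwa [norm_neg]), eulerPhi_eq_mul hx, neg_sq]
  simp_rw [Odd.neg_pow (odd_two_mul_add_one _), ← sub_eq_add_neg]
  ring

lemma dedekindEta_eq (τ : ℂ) :
    dedekindEta τ = exp (Real.pi * I * τ / 12) * eulerPhi (exp (2 * Real.pi * I * τ)) := by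
  unfold dedekindEta eulerPhi
  congr 1
  refine tprod_congr fun n => ?_
  rw [← Complex.exp_nat_mul]
  push_cast
  ring_nf

lemma jTheta_zero_two (τ z : ℂ) :
    jTheta 0 2 τ z = ∑' n : ℤ, jacobiTheta₂_term (2 * n) z τ := by
  unfold jTheta jacobiTheta₂_term
  refine tsum_congr fun n => congrArg exp ?_
  push_cast
  ring

lemma jTheta_two_two (τ z : ℂ) :
    jTheta 2 2 τ z = ∑' n : ℤ, jacobiTheta₂_term (2 * n + 1) z τ := by
  unfold jTheta jacobiTheta₂_term
  refine tsum_congr fun n => congrArg exp ?_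
  push_cast
  ring

lemma bijective_even_odd :
    Function.Bijective (Sum.elim (fun n : ℤ => 2 * n) fun n : ℤ => 2 * n + 1) := by
  constructor
  · rintro (a | a) (b | b) h <;> simp only [Sum.elim_inl, Sum.elim_inr] at h <;>
      first | omega | (congr 1; omega)
  · intro n
    rcases Int.even_or_odd' n with ⟨k, rfl | rfl⟩
    exacts [⟨Sum.inl k, rfl⟩, ⟨Sum.inr k, rfl⟩]

lemma tsum_int_even_add_odd {f : ℤ → ℂ} (hf : Summable f) :
    ∑' n, f (2 * n) + ∑' n, f (2 * n + 1) = ∑' n, f n := by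
  rw [← (Equiv.ofBijective _ bijective_even_odd).tsum_eq f, Summable.tsum_sum]
  · rfl
  · exact hf.comp_injective fun a b h => by simpa using h
  · exact hf.comp_injective fun a b h => by simpa using h

lemma natAbs_sq_even (n : ℤ) : Even ((2 * n).natAbs ^ 2) := by
  simp [Int.natAbs_mul, parity_simps]

lemma natAbs_sq_odd (n : ℤ) : Odd ((2 * n + 1).natAbs ^ 2) :=
  (Int.natAbs_odd.mpr (odd_two_mul_add_one n)).pow

lemma jacobiTheta₂_term_zero (n : ℤ) (τ : ℂ) :
    jacobiTheta₂_term n 0 τ = exp (Real.pi * I * τ) ^ n.natAbs ^ 2 := by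
  rw [jacobiTheta₂_term, ← Complex.exp_nat_mul]
  congr 1
  have : ((n.natAbs ^ 2 : ℕ) : ℂ) = (n : ℂ) ^ 2 := by
    rw [← Int.cast_pow, ← Int.natAbs_sq]
    norm_cast
  rw [this]
  ring

lemma norm_exp_pi_I_mul_lt_one {τ : ℂ} (hτ : 0 < τ.im) : ‖exp (Real.pi * I * τ)‖ < 1 := by
  rw [Complex.norm_exp, Real.exp_lt_one_iff]
  simpa using mul_pos Real.pi_pos hτ

lemma v00_zero {τ : ℂ} (hτ : 0 < τ.im) :
    v00 τ 0 = ∑' k : ℤ, exp (Real.pi * I * τ) ^ k.natAbs ^ 2 := by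
  rw [v00, jTheta_zero_two, jTheta_two_two,
    ← tsum_int_even_add_odd (summable_norm_pow_natAbs_sq (norm_exp_pi_I_mul_lt_one hτ)).of_norm]
  simp_rw [jacobiTheta₂_term_zero]

lemma v01_zero {τ : ℂ} (hτ : 0 < τ.im) :
    v01 τ 0 = ∑' k : ℤ, (-exp (Real.pi * I * τ)) ^ k.natAbs ^ 2 := by
  have hx : ‖-exp (Real.pi * I * τ)‖ < 1 := by
    rw [norm_neg]
    exact norm_exp_pi_I_mul_lt_one hτ
  rw [v01, jTheta_zero_two, jTheta_two_two,
    ← tsum_int_even_add_odd (summable_norm_pow_natAbs_sq hx).of_norm]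
  simp_rw [jacobiTheta₂_term_zero, (natAbs_sq_even _).neg_pow, (natAbs_sq_odd _).neg_pow]
  rw [tsum_neg, sub_eq_add_neg]

lemma bijective_sum_sub :
    Function.Bijective (Sum.elim (fun p : ℤ × ℤ => (p.1 + p.2, p.1 - p.2))
      fun p : ℤ × ℤ => (p.1 + p.2, p.1 - p.2 - 1)) := by
  constructor
  · rintro (a | a) (b | b) h <;> simp only [Sum.elim_inl, Sum.elim_inr, Prod.mk.injEq] at h <;>
      first | omega | (congr 1; ext <;> omega)
  · rintro ⟨k, l⟩
    rcases Int.even_or_odd' (k + l) with ⟨t, h | h⟩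
    · refine ⟨Sum.inl (t, k - t), ?_⟩
      simp only [Sum.elim_inl, Prod.mk.injEq]
      omega
    · refine ⟨Sum.inr (t + 1, k - t - 1), ?_⟩
      simp only [Sum.elim_inr, Prod.mk.injEq]
      omega

lemma jTheta_one_one_sq {τ : ℂ} (hτ : 0 < τ.im) (z : ℂ) :
    jTheta 1 1 τ z ^ 2 =
      jTheta 2 2 τ z * jTheta 0 2 τ 0 + jTheta 0 2 τ z * jTheta 2 2 τ 0 := by
  have hT : ∀ w, Summable fun n => ‖jacobiTheta₂_term n w τ‖ := fun w =>
    ((summable_jacobiTheta₂_term_iff w τ).mpr hτ).norm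
  have he : ∀ w, Summable fun n : ℤ => ‖jacobiTheta₂_term (2 * n) w τ‖ := fun w =>
    (hT w).comp_injective fun a b h => by simpa using h
  have ho : ∀ w, Summable fun n : ℤ => ‖jacobiTheta₂_term (2 * n + 1) w τ‖ := fun w =>
    (hT w).comp_injective fun a b h => by simpa using h
  set g : ℤ → ℂ := fun n => exp (2 * Real.pi * I * ((n + 1 / 2) ^ 2 * τ + (n + 1 / 2) * z)) with hg
  have hj : jTheta 1 1 τ z = ∑' n, g n := by
    unfold jTheta
    refine tsum_congr fun n => congrArg exp ?_
    push_cast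
    ring
  have hgs : Summable fun n => ‖g n‖ := by
    have h := (((summable_jacobiTheta₂_term_iff (τ + z) (2 * τ)).mpr (by simpa using hτ)).mul_left
      (exp (2 * Real.pi * I * (τ / 4 + z / 2)))).norm
    refine h.congr fun n => ?_
    rw [hg, jacobiTheta₂_term, ← Complex.exp_add]
    ring_nf
  rw [hj, sq, tsum_mul_tsum_of_summable_norm hgs hgs,
    ← (Equiv.ofBijective _ bijective_sum_sub).tsum_eq, jTheta_two_two, jTheta_two_two,
    jTheta_zero_two, jTheta_zero_two, tsum_mul_tsum_of_summable_norm (ho z) (he 0),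
    tsum_mul_tsum_of_summable_norm (he z) (ho 0)]
  have e1 : ∀ p : ℤ × ℤ, g (p.1 + p.2) * g (p.1 - p.2) =
      jacobiTheta₂_term (2 * p.1 + 1) z τ * jacobiTheta₂_term (2 * p.2) 0 τ := fun p => by
    simp only [hg, jacobiTheta₂_term, ← Complex.exp_add]
    push_cast
    ring_nf
  have e2 : ∀ p : ℤ × ℤ, g (p.1 + p.2) * g (p.1 - p.2 - 1) =
      jacobiTheta₂_term (2 * p.1) z τ * jacobiTheta₂_term (2 * p.2 + 1) 0 τ := fun p => by
    simp only [hg, jacobiTheta₂_term, ← Complex.exp_add]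
    push_cast
    ring_nf
  rw [Summable.tsum_sum]
  · exact congrArg₂ (· + ·) (tsum_congr e1) (tsum_congr e2)
  · exact (summable_mul_of_summable_norm (ho z) (he 0)).congr fun p => (e1 p).symm
  · exact (summable_mul_of_summable_norm (he z) (ho 0)).congr fun p => (e2 p).symm

lemma dedekindEta_ne_zero {τ : ℂ} (hτ : 0 < τ.im) : dedekindEta τ ≠ 0 := by
  rw [dedekindEta_eq]
  refine mul_ne_zero (exp_ne_zero _) (eulerPhi_ne_zero ?_)
  have h := norm_exp_pi_I_mul_lt_one (τ := 2 * τ) (by simpa using hτ)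
  rwa [show (Real.pi : ℂ) * I * (2 * τ) = 2 * Real.pi * I * τ by ring] at h

/-- The three eta values are `w φ(x)`, `w² φ(x²)`, `w⁴ φ(x⁴)` with `x = e^{πiτ}`, `w = e^{πiτ/24}`. -/
lemma dedekindEta_half_self_two (τ : ℂ) :
    dedekindEta (τ / 2) = exp (Real.pi * I * τ / 24) * eulerPhi (exp (Real.pi * I * τ)) ∧
    dedekindEta τ = exp (Real.pi * I * τ / 24) ^ 2 * eulerPhi (exp (Real.pi * I * τ) ^ 2) ∧
    dedekindEta (2 * τ) = exp (Real.pi * I * τ / 24) ^ 4 * eulerPhi (exp (Real.pi * I * τ) ^ 4) := by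
  simp only [dedekindEta_eq, ← Complex.exp_nat_mul]
  push_cast
  refine ⟨?_, ?_, ?_⟩ <;> ring_nf

lemma v00_zero_mul {τ : ℂ} (hτ : 0 < τ.im) :
    v00 τ 0 * (dedekindEta (τ / 2) * dedekindEta (2 * τ)) ^ 2 = dedekindEta τ ^ 5 := by
  obtain ⟨h1, h2, h3⟩ := dedekindEta_half_self_two τ
  rw [h1, h2, h3, v00_zero hτ]
  linear_combination exp (Real.pi * I * τ / 24) ^ 10 *
    tsum_pow_natAbs_sq_mul (exp_ne_zero _) (norm_exp_pi_I_mul_lt_one hτ)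

lemma v01_zero_mul {τ : ℂ} (hτ : 0 < τ.im) :
    v01 τ 0 * dedekindEta τ = dedekindEta (τ / 2) ^ 2 := by
  obtain ⟨h1, h2, -⟩ := dedekindEta_half_self_two τ
  rw [h1, h2, v01_zero hτ]
  linear_combination exp (Real.pi * I * τ / 24) ^ 2 *
    tsum_neg_pow_natAbs_sq_mul (exp_ne_zero _) (norm_exp_pi_I_mul_lt_one hτ)

/-- Proposition 3.2 (3). -/
theorem stmt_6 (τ : ℂ) (hτ : 0 < τ.im) (z : ℂ) :
    ch11 τ z ^ 2 =
      (1 / 2) * (dedekindEta τ ^ 3 / (dedekindEta (τ / 2) * dedekindEta (2 * τ))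
          - dedekindEta (τ / 2) * dedekindEta (2 * τ) / dedekindEta τ ^ 2) * ch20 τ z
        - (1 / 2) * (dedekindEta τ ^ 3 / (dedekindEta (τ / 2) * dedekindEta (2 * τ))
          + dedekindEta (τ / 2) * dedekindEta (2 * τ) / dedekindEta τ ^ 2) * ch22 τ z := by
  have n1 : dedekindEta (τ / 2) ≠ 0 := dedekindEta_ne_zero (by simpa using hτ)
  have n2 : dedekindEta τ ≠ 0 := dedekindEta_ne_zero hτ
  have n3 : dedekindEta (2 * τ) ≠ 0 := dedekindEta_ne_zero (by simpa using hτ)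
  have hθ : jTheta 1 1 τ z ^ 2 = (v00 τ 0 * v00 τ z - v01 τ 0 * v01 τ z) / 2 := by
    rw [jTheta_one_one_sq hτ]
    simp only [v00, v01]
    ring
  have h0 : v00 τ 0 = dedekindEta τ ^ 5 / (dedekindEta (τ / 2) * dedekindEta (2 * τ)) ^ 2 := by
    rw [eq_div_iff (by positivity), v00_zero_mul hτ]
  have h1 : v01 τ 0 = dedekindEta (τ / 2) ^ 2 / dedekindEta τ := by
    rw [eq_div_iff n2, v01_zero_mul hτ]
  rw [ch11, mul_pow, div_pow, hθ, h0, h1, neg_sq, I_sq, ch20, ch22]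
  generalize dedekindEta (τ / 2) = a, dedekindEta (2 * τ) = b at *
  field_simp
  ring
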